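/- Let θ ∈ ℝ be irrational, let L²(𝕋) carry the standard orthonormal basis {ε_k(z) = z^k : k ∈ ℤ}, and let α_k(g)(z) = g(e^{2πikθ} z) be the rotation action of ℤ on L^∞(𝕋). On K = ℓ²(ℤ, L²(𝕋)) define (π(g)ξ)(m) = M_{α_{−m}(g)}(ξ(m)) for g ∈ L^∞(𝕋) and (U(k)ξ)(m) = ξ(m − k) for k ∈ ℤ, and let 𝒩_θ := ({π(g) : g ∈ L^∞(𝕋)} ∪ {U(k) : k ∈ ℤ})'' be the von Neumann crossed product L^∞(𝕋) ⊗_α ℤ associated to the rotation algebra. For n ∈ ℕ₀ let Q_n be the orthogonal projection of L²(𝕋) onto span{ε_0, …, ε_n}, let P_n be the orthogonal projection of ℓ²(ℤ) onto functions supported in {−n, …, n}, and define R_n := P_n ⊗ Q_n on K, i.e. (R_n ξ)(m) = Q_n(ξ(m)) for |m| ≤ n and (R_n ξ)(m) = 0 for |m| > n. Then {R_n}_{n∈ℕ₀} is a Følner sequence for 𝒩_θ: for every N ∈ 𝒩_θ, lim_{n→∞} ‖N R_n − R_n N‖₂ / ‖R_n‖₂ = 0. -/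

import Mathlib

open Filter MeasureTheory AddCircle
open scoped ENNReal

instance : Fact ((0:ℝ) < 1) := ⟨one_pos⟩

/-- Normalised Haar measure on the circle `𝕋 = ℝ/ℤ`. -/
noncomputable abbrev μT : Measure (AddCircle (1:ℝ)) := haarAddCircle

noncomputable def hsNorm {H : Type*} [NormedAddCommGroup H] [InnerProductSpace ℂ H]
    {ι : Type*} (e : HilbertBasis ι ℂ H) (A : H →L[ℂ] H) : ℝ :=
  Real.sqrt (∑' i, ‖A (e i)‖ ^ 2)

section HilbertSchmidt

open scoped InnerProductSpace

variable {H : Type*} [NormedAddCommGroup H] [InnerProductSpace ℂ H]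

/-- Parseval's identity, valued in `ℝ≥0∞`. -/
theorem HilbertBasis.tsum_enorm_inner_sq {ι : Type*} (b : HilbertBasis ι ℂ H) (x : H) :
    ∑' i, ‖⟪b i, x⟫_ℂ‖ₑ ^ 2 = ‖x‖ₑ ^ 2 := by
  have h := lp.hasSum_norm (p := 2) (by norm_num) (b.repr x)
  simp only [ENNReal.toReal_ofNat, Real.rpow_ofNat, LinearIsometryEquiv.norm_map,
    HilbertBasis.repr_apply_apply] at h
  have h' := ENNReal.ofReal_tsum_of_nonneg (fun i => by positivity) h.summable
  rw [h.tsum_eq] at h'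
  simpa [ENNReal.ofReal_pow, ofReal_norm] using h'.symm

theorem HilbertBasis.tsum_enorm_apply_sq [CompleteSpace H] {ι κ : Type*}
    (e : HilbertBasis ι ℂ H) (f : HilbertBasis κ ℂ H) (A : H →L[ℂ] H) :
    ∑' i, ‖A (e i)‖ₑ ^ 2 = ∑' k, ‖ContinuousLinearMap.adjoint A (f k)‖ₑ ^ 2 := by
  simp_rw [← f.tsum_enorm_inner_sq (A _)]
  rw [ENNReal.tsum_comm]
  refine tsum_congr fun k => ?_
  rw [← e.tsum_enorm_inner_sq]
  refine tsum_congr fun i => ?_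
  rw [ContinuousLinearMap.adjoint_inner_right, ← inner_conj_symm, RCLike.enorm_conj]

/-- The Hilbert–Schmidt norm can be computed in any Hilbert basis. -/
theorem hsNorm_eq_sqrt_toReal [CompleteSpace H] {ι κ : Type*}
    (e : HilbertBasis ι ℂ H) (f : HilbertBasis κ ℂ H) (A : H →L[ℂ] H) :
    hsNorm e A = Real.sqrt (∑' k, ‖A (f k)‖ₑ ^ 2).toReal := by
  rw [f.tsum_enorm_apply_sq f, ← e.tsum_enorm_apply_sq f,
    ENNReal.tsum_toReal_eq (fun i => by simp), hsNorm]
  simp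

variable {G : Type*} [AddCommGroup G]

open Classical in
/-- The number of points of `F` that leave `F` under translation by `w`. -/
noncomputable def outCard (F : Finset G) (w : G) : ℕ := (F.filter fun v => v + w ∉ F).card

open Classical in
theorem outCard_le (F : Finset G) (w : G) : outCard F w ≤ F.card :=
  Finset.card_filter_le _ _

open Classical in
theorem tsum_ite_mem_translate_notMem (F : Finset G) (w : G) :
    ∑' v, (if v ∈ F ∧ v + w ∉ F then 1 else 0 : ℝ≥0∞) = outCard F w := by
  have h : ∀ v ∉ F.filter (fun v => v + w ∉ F),
      (if v ∈ F ∧ v + w ∉ F then 1 else 0 : ℝ≥0∞) = 0 :=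
    fun v hv => if_neg fun h => hv (Finset.mem_filter.2 h)
  rw [tsum_eq_sum h, outCard, Finset.card_eq_sum_ones]
  push_cast
  exact Finset.sum_congr rfl fun v hv => if_pos (Finset.mem_filter.1 hv)

open Classical in
theorem tsum_enorm_commutator_sq (b : HilbertBasis G ℂ H) (N P : H →L[ℂ] H) (F : Finset G)
    (hN : ∀ u v w, ‖⟪b (u + w), N (b (v + w))⟫_ℂ‖ₑ = ‖⟪b u, N (b v)⟫_ℂ‖ₑ)
    (hP : ∀ v, P (b v) = if v ∈ F then b v else 0)
    (hP' : ∀ u x, ⟪b u, P x⟫_ℂ = if u ∈ F then ⟪b u, x⟫_ℂ else 0) :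
    ∑' v, ‖(N * P - P * N) (b v)‖ₑ ^ 2
      = ∑' w, ‖⟪b w, N (b 0)⟫_ℂ‖ₑ ^ 2 * (outCard F w + outCard F (-w)) := by
  have key : ∀ v w, ‖⟪b (v + w), (N * P - P * N) (b v)⟫_ℂ‖ₑ ^ 2
      = ‖⟪b w, N (b 0)⟫_ℂ‖ₑ ^ 2 * ((if v ∈ F ∧ v + w ∉ F then 1 else 0)
        + (if v + w ∈ F ∧ v + w + -w ∉ F then 1 else 0)) := by
    intro v w
    have h := hN w 0 v
    rw [zero_add, add_comm w v] at h
    rw [← h]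
    simp only [sub_apply, mul_apply_eq_comp, inner_sub_right,
      hP', hP, add_neg_cancel_right]
    by_cases h1 : v ∈ F <;> by_cases h2 : v + w ∈ F <;> simp [h1, h2]
  calc _ = ∑' v, ∑' w, ‖⟪b (v + w), (N * P - P * N) (b v)⟫_ℂ‖ₑ ^ 2 := by
        refine tsum_congr fun v => ?_
        rw [← b.tsum_enorm_inner_sq]
        exact ((Equiv.addLeft v).tsum_eq
          (fun u => ‖⟪b u, (N * P - P * N) (b v)⟫_ℂ‖ₑ ^ 2)).symm
    _ = _ := by
        rw [ENNReal.tsum_comm]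
        refine tsum_congr fun w => ?_
        simp_rw [key]
        rw [ENNReal.tsum_mul_left, ENNReal.tsum_add, tsum_ite_mem_translate_notMem]
        congr 2
        rw [← tsum_ite_mem_translate_notMem]
        exact (Equiv.addRight w).tsum_eq (fun u => if u ∈ F ∧ u + -w ∉ F then (1 : ℝ≥0∞) else 0)

open Classical in
theorem tsum_enorm_coordProj_sq {κ : Type*} (b : HilbertBasis κ ℂ H) (P : H →L[ℂ] H) (F : Finset κ)
    (hP : ∀ v, P (b v) = if v ∈ F then b v else 0) :
    ∑' v, ‖P (b v)‖ₑ ^ 2 = F.card := by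
  have h : ∀ v, ‖b v‖ₑ = 1 := fun v => by
    rw [← ofReal_norm, b.orthonormal.1 v, ENNReal.ofReal_one]
  rw [tsum_eq_sum (s := F), Finset.card_eq_sum_ones]
  · push_cast
    refine Finset.sum_congr rfl fun v hv => by simp [hP, hv, h]
  · intro v hv
    simp [hP, hv]

open Classical in
/-- Coordinate projections onto a Følner sequence of finite subsets of a group form a Følner
sequence for every operator whose matrix entries have translation invariant absolute values. -/
theorem tendsto_hsNorm_commutator_div [CompleteSpace H] {ι : Type*} (e : HilbertBasis ι ℂ H)
    (b : HilbertBasis G ℂ H) (N : H →L[ℂ] H) (P : ℕ → H →L[ℂ] H) (F : ℕ → Finset G)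
    (hN : ∀ u v w, ‖⟪b (u + w), N (b (v + w))⟫_ℂ‖ₑ = ‖⟪b u, N (b v)⟫_ℂ‖ₑ)
    (hP : ∀ n v, P n (b v) = if v ∈ F n then b v else 0)
    (hP' : ∀ n u x, ⟪b u, P n x⟫_ℂ = if u ∈ F n then ⟪b u, x⟫_ℂ else 0)
    (hF : ∀ w, Tendsto (fun n => (outCard (F n) w : ℝ) / (F n).card) atTop (nhds 0)) :
    Tendsto (fun n => hsNorm e (N * P n - P n * N) / hsNorm e (P n)) atTop (nhds 0) := by
  set a : G → ℝ := fun w => ‖⟪b w, N (b 0)⟫_ℂ‖ ^ 2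
  have ha : Summable a := by
    have h := lp.hasSum_norm (p := 2) (by norm_num) (b.repr (N (b 0)))
    simpa [HilbertBasis.repr_apply_apply] using h.summable
  have hratio : ∀ n, hsNorm e (N * P n - P n * N) / hsNorm e (P n)
      = Real.sqrt (∑' w, a w * ((outCard (F n) w : ℝ) / (F n).card
        + (outCard (F n) (-w) : ℝ) / (F n).card)) := by
    intro n
    rw [hsNorm_eq_sqrt_toReal e b, hsNorm_eq_sqrt_toReal e b,
      tsum_enorm_commutator_sq b N (P n) (F n) hN (hP n) (hP' n),
      tsum_enorm_coordProj_sq b (P n) (F n) (hP n), ← Real.sqrt_div ENNReal.toReal_nonneg,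
      ENNReal.tsum_toReal_eq (fun w => ENNReal.mul_ne_top (by simp) (by simp)), ← tsum_div_const]
    congr 1
    refine tsum_congr fun w => ?_
    rw [ENNReal.toReal_mul, ENNReal.toReal_add (by simp) (by simp)]
    simp [a]
    ring
  simp_rw [hratio]
  rw [← Real.sqrt_zero]
  refine (Real.continuous_sqrt.tendsto 0).comp ?_
  have hle : ∀ n w, (outCard (F n) w : ℝ) / (F n).card ≤ 1 := fun n w =>
    div_le_one_of_le₀ (by exact_mod_cast outCard_le _ _) (by positivity)
  have := tendsto_tsum_of_dominated_convergence (𝓕 := atTop) (bound := fun w => a w * 2)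
    (f := fun n w => a w * ((outCard (F n) w : ℝ) / (F n).card
        + (outCard (F n) (-w) : ℝ) / (F n).card)) (g := fun _ => 0) (ha.mul_right 2)
    (fun w => by simpa using ((hF w).add (hF (-w))).const_mul (a w))
    (Eventually.of_forall fun n w => by
      have ha0 : 0 ≤ a w := by positivity
      rw [Real.norm_of_nonneg (by positivity)]
      have h1 := hle n w
      have h2 := hle n (-w)
      gcongr
      linarith)
  simpa using this

end HilbertSchmidt

section Boxes

theorem card_filter_Icc_add_notMem_le (a b p : ℤ) :
    ((Finset.Icc a b).filter fun m => m + p ∉ Finset.Icc a b).card ≤ p.natAbs := by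
  have : ((Finset.Icc a b).filter fun m => m + p ∉ Finset.Icc a b)
      ⊆ Finset.Ioc (b - p) b ∪ Finset.Ico a (a - p) := by
    intro m
    simp only [Finset.mem_filter, Finset.mem_Icc, Finset.mem_union, Finset.mem_Ioc,
      Finset.mem_Ico]
    omega
  refine (Finset.card_le_card this).trans ((Finset.card_union_le _ _).trans ?_)
  simp only [Int.card_Ioc, Int.card_Ico]
  omega

/-- The box `{-n, …, n} × {0, …, n}`. -/
noncomputable def box (n : ℕ) : Finset (ℤ × ℤ) := Finset.Icc (-(n : ℤ)) n ×ˢ Finset.Icc 0 (n : ℤ)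

theorem card_box (n : ℕ) : (box n).card = (2 * n + 1) * (n + 1) := by
  rw [box, Finset.card_product, Int.card_Icc, Int.card_Icc]
  congr 1
  all_goals omega

theorem outCard_box_le (n : ℕ) (w : ℤ × ℤ) :
    outCard (box n) w ≤ w.1.natAbs * (n + 1) + (2 * n + 1) * w.2.natAbs := by
  classical
  have hsub : ((box n).filter fun v => v + w ∉ box n) ⊆
      ((Finset.Icc (-(n : ℤ)) n).filter fun m => m + w.1 ∉ Finset.Icc (-(n : ℤ)) n)
          ×ˢ Finset.Icc 0 (n : ℤ) ∪
        Finset.Icc (-(n : ℤ)) n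
          ×ˢ ((Finset.Icc 0 (n : ℤ)).filter fun m => m + w.2 ∉ Finset.Icc 0 (n : ℤ)) := by
    intro v
    simp only [box, Finset.mem_filter, Finset.mem_product, Finset.mem_union, Prod.fst_add,
      Prod.snd_add]
    tauto
  have h1 := card_filter_Icc_add_notMem_le (-(n : ℤ)) n w.1
  have h2 := card_filter_Icc_add_notMem_le 0 (n : ℤ) w.2
  have h3 : (Finset.Icc (-(n : ℤ)) n).card = 2 * n + 1 := by rw [Int.card_Icc]; omega
  have h4 : (Finset.Icc 0 (n : ℤ)).card = n + 1 := by rw [Int.card_Icc]; omega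
  calc outCard (box n) w ≤ _ := by
        refine le_trans (Eq.le ?_) ((Finset.card_le_card hsub).trans (Finset.card_union_le _ _))
        unfold outCard
        congr
    _ ≤ _ := by
        rw [Finset.card_product, Finset.card_product, h3, h4]
        gcongr

theorem tendsto_outCard_box_div (w : ℤ × ℤ) :
    Tendsto (fun n => (outCard (box n) w : ℝ) / (box n).card) atTop (nhds 0) := by
  have hlim : Tendsto (fun n : ℕ => ((w.1.natAbs : ℝ) + w.2.natAbs) * (1 / ((n : ℝ) + 1))) atTop
      (nhds 0) := by
    simpa using (tendsto_one_div_add_atTop_nhds_zero_nat (𝕜 := ℝ)).const_mul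
      ((w.1.natAbs : ℝ) + w.2.natAbs)
  refine squeeze_zero (fun n => by positivity) (fun n => ?_) hlim
  have h : (outCard (box n) w : ℝ) ≤ w.1.natAbs * (n + 1) + (2 * n + 1) * w.2.natAbs := by
    exact_mod_cast outCard_box_le n w
  rw [card_box, mul_one_div, div_le_div_iff₀ (by positivity) (by positivity)]
  push_cast
  refine (mul_le_mul_of_nonneg_right h (by positivity)).trans ?_
  rw [← sub_nonneg]
  have : 0 ≤ (w.1.natAbs : ℝ) * (n + 1) * n := by positivity
  linarith

end Boxes

section LpSum

open scoped InnerProductSpace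

variable {I κ E : Type*} [NormedAddCommGroup E] [InnerProductSpace ℂ E]

/-- The Hilbert basis `δ_i ⊗ b_k` of `ℓ²(I, E)` obtained from a Hilbert basis `b` of `E`. -/
noncomputable def HilbertBasis.lpSingle [CompleteSpace E] [DecidableEq I]
    (b : HilbertBasis κ ℂ E) : HilbertBasis (I × κ) ℂ (lp (fun _ : I => E) 2) :=
  HilbertBasis.mkOfOrthogonalEqBot
    (v := fun u : I × κ => (lp.single 2 u.1 (b u.2) : lp (fun _ : I => E) 2))
    (by
      classical
      rw [orthonormal_iff_ite]
      rintro ⟨i, k⟩ ⟨j, l⟩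
      have h := orthonormal_iff_ite.1 b.orthonormal k l
      rw [lp.inner_single_left, lp.single_apply]
      by_cases hij : i = j
      · subst hij
        simpa using h
      · simp [hij])
    (by
      rw [Submodule.eq_bot_iff]
      intro x hx
      ext1
      funext i
      rw [Submodule.mem_orthogonal] at hx
      refine b.repr.injective ?_
      ext k
      have h := hx _ (Submodule.subset_span ⟨(i, k), rfl⟩)
      rw [lp.inner_single_left] at h
      simpa [HilbertBasis.repr_apply_apply] using h)

theorem HilbertBasis.lpSingle_apply [CompleteSpace E] [DecidableEq I]
    (b : HilbertBasis κ ℂ E) (u : I × κ) :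
    b.lpSingle u = (lp.single 2 u.1 (b u.2) : lp (fun _ : I => E) 2) := by
  simp [HilbertBasis.lpSingle]

/-- The linear isometry `1 ⊗ L` of `ℓ²(I, E)`. -/
noncomputable def lpFiberwise (L : E →ₗᵢ[ℂ] E) :
    lp (fun _ : I => E) 2 →ₗᵢ[ℂ] lp (fun _ : I => E) 2 where
  toFun ξ := ⟨fun i => L (ξ i), by
    have h := lp.memℓp ξ
    rw [memℓp_gen_iff (by norm_num)] at h
    refine memℓp_gen (p := 2) ?_
    simpa using h⟩
  map_add' ξ η := by
    ext1
    funext i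
    exact L.map_add _ _
  map_smul' c ξ := by
    ext1
    funext i
    exact L.map_smul _ _
  norm_map' ξ := by
    simp [lp.norm_eq_tsum_rpow]

theorem lpFiberwise_apply (L : E →ₗᵢ[ℂ] E) (ξ : lp (fun _ : I => E) 2) (i : I) :
    lpFiberwise L ξ i = L (ξ i) := rfl

theorem lpFiberwise_single [DecidableEq I] (L : E →ₗᵢ[ℂ] E) (i : I) (a : E) :
    lpFiberwise L (lp.single 2 i a) = lp.single 2 i (L a) := by
  ext1
  funext j
  rw [lpFiberwise_apply, lp.single_apply, lp.single_apply]
  by_cases h : j = i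
  · subst h
    simp
  · simp [h]

end LpSum

section Circle

/-- Translation by `s` followed by multiplication by the character `fourier q`, as a linear
isometry of `L²(𝕋)`. -/
noncomputable def translateModulate (s : AddCircle (1 : ℝ)) (q : ℤ) :
    Lp ℂ 2 μT →ₗᵢ[ℂ] Lp ℂ 2 μT where
  toFun f := (fourierLp ∞ q : Lp ℂ ∞ μT) •
    Lp.compMeasurePreserving (· - s) (measurePreserving_sub_right μT s) f
  map_add' f g := by rw [map_add, Lp.add_smul]
  map_smul' c f := by
    have : Lp.compMeasurePreserving (· - s) (measurePreserving_sub_right μT s) (c • f)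
        = c • Lp.compMeasurePreserving (· - s) (measurePreserving_sub_right μT s) f :=
      (Lp.compMeasurePreservingₗ ℂ (· - s) (measurePreserving_sub_right μT s)).map_smul c f
    rw [this, RingHom.id_apply, Lp.smul_comm]
  norm_map' f := by
    rw [← Lp.norm_compMeasurePreserving f (measurePreserving_sub_right μT s)]
    refine congrArg ENNReal.toReal (eLpNorm_congr_norm_ae ?_)
    filter_upwards [Lp.coeFn_lpSMul (r := 2) (fourierLp ∞ q : Lp ℂ ∞ μT)
      (Lp.compMeasurePreserving (· - s) (measurePreserving_sub_right μT s) f),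
      coeFn_fourierLp (T := 1) ∞ q] with x h1 h2
    refine (congrArg norm h1).trans ?_
    rw [Pi.smul_apply', h2, norm_smul, fourier_apply, Circle.norm_coe, one_mul]

theorem coeFn_translateModulate (s : AddCircle (1 : ℝ)) (q : ℤ) (f : Lp ℂ 2 μT) :
    (translateModulate s q f : AddCircle (1 : ℝ) → ℂ) =ᵐ[μT]
      fun x => fourier q x * (f : AddCircle (1 : ℝ) → ℂ) (x - s) := by
  filter_upwards [Lp.coeFn_lpSMul (r := 2) (fourierLp ∞ q : Lp ℂ ∞ μT)
      (Lp.compMeasurePreserving (· - s) (measurePreserving_sub_right μT s) f),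
      coeFn_fourierLp (T := 1) ∞ q,
      Lp.coeFn_compMeasurePreserving f (measurePreserving_sub_right μT s)] with x h1 h2 h3
  refine h1.trans ?_
  simp only [Pi.smul_apply', h2, h3]
  rfl

theorem translateModulate_fourierLp (s : AddCircle (1 : ℝ)) (q k : ℤ) :
    translateModulate s q (fourierLp 2 k)
      = (fourier k (-s) : ℂ) • (fourierLp 2 (k + q) : Lp ℂ 2 μT) := by
  refine Lp.ext ?_
  filter_upwards [coeFn_translateModulate s q (fourierLp 2 k),
    (measurePreserving_sub_right μT s).quasiMeasurePreserving.ae (coeFn_fourierLp (T := 1) 2 k),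
    coeFn_fourierLp (T := 1) 2 (k + q),
    Lp.coeFn_smul (fourier k (-s) : ℂ) (fourierLp 2 (k + q) : Lp ℂ 2 μT)] with x h1 h2 h3 h4
  rw [h1, h2, h4, Pi.smul_apply, h3, smul_eq_mul, fourier_add]
  simp only [fourier_apply, sub_eq_add_neg, smul_add, toCircle_add, Circle.coe_mul]
  ring

/-- The orthogonal projection onto `span {ε_0, …, ε_n}` acts diagonally on the characters. -/
theorem proj_fourierLp (n : ℕ) (Q : Lp ℂ 2 μT →L[ℂ] Lp ℂ 2 μT)
    (hsa : IsSelfAdjoint Q) (hidem : Q * Q = Q)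
    (hrange : LinearMap.range (Q : Lp ℂ 2 μT →ₗ[ℂ] Lp ℂ 2 μT)
      = Submodule.span ℂ {h : Lp ℂ 2 μT | ∃ k : ℕ, k ≤ n ∧ h = fourierLp 2 (k : ℤ)}) (k : ℤ) :
    Q (fourierLp 2 k) = if k ∈ Finset.Icc 0 (n : ℤ) then fourierLp 2 k else 0 := by
  have hQQ : ∀ x, Q (Q x) = Q x := fun x => DFunLike.congr_fun hidem x
  split_ifs with hk
  · rw [Finset.mem_Icc] at hk
    have hmem : (fourierLp 2 k : Lp ℂ 2 μT) ∈
        LinearMap.range (Q : Lp ℂ 2 μT →ₗ[ℂ] Lp ℂ 2 μT) := by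
      rw [hrange]
      exact Submodule.subset_span ⟨k.toNat, by omega, by rw [Int.toNat_of_nonneg hk.1]⟩
    obtain ⟨y, hy⟩ := hmem
    rw [← hy]
    exact hQQ y
  · have horth : ∀ y ∈ LinearMap.range (Q : Lp ℂ 2 μT →ₗ[ℂ] Lp ℂ 2 μT),
        inner ℂ (fourierLp 2 k : Lp ℂ 2 μT) y = 0 := by
      intro y hy
      rw [hrange] at hy
      induction hy using Submodule.span_induction with
      | mem y hy =>
        obtain ⟨j, hj, rfl⟩ := hy
        refine orthonormal_fourier.2 ?_
        rintro rfl
        exact hk (by simp [hj])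
      | zero => exact inner_zero_right _
      | add y z _ _ hy hz => rw [inner_add_right, hy, hz, add_zero]
      | smul c y _ hy => rw [inner_smul_right, hy, mul_zero]
    rw [← inner_self_eq_zero (𝕜 := ℂ)]
    have hadj := ContinuousLinearMap.adjoint_inner_left Q (Q (fourierLp 2 k)) (fourierLp 2 k)
    rw [hsa.adjoint_eq, hQQ] at hadj
    rw [hadj]
    exact horth _ ⟨_, rfl⟩

end Circle

/-- Matrix entries of elements of the crossed product `L^∞(𝕋) ⊗_α ℤ` with respect to the basis
`δ_m ⊗ ε_k` have translation invariant absolute values. -/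
theorem enorm_inner_crossedProduct_add (θ : ℝ)
    (π : Lp ℂ ∞ μT → (lp (fun _ : ℤ => Lp ℂ 2 μT) 2 →L[ℂ] lp (fun _ : ℤ => Lp ℂ 2 μT) 2))
    (hπ : ∀ (g : Lp ℂ ∞ μT) (ξ : lp (fun _ : ℤ => Lp ℂ 2 μT) 2) (m : ℤ),
      ((π g ξ) m : AddCircle (1:ℝ) → ℂ) =ᵐ[μT]
        fun x => (g : AddCircle (1:ℝ) → ℂ) (x - (((m:ℝ) * θ : ℝ) : AddCircle (1:ℝ)))
          * ((ξ m : Lp ℂ 2 μT) : AddCircle (1:ℝ) → ℂ) x)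
    (U : ℤ → (lp (fun _ : ℤ => Lp ℂ 2 μT) 2 →L[ℂ] lp (fun _ : ℤ => Lp ℂ 2 μT) 2))
    (hU : ∀ (k : ℤ) (ξ : lp (fun _ : ℤ => Lp ℂ 2 μT) 2) (m : ℤ), (U k ξ) m = ξ (m - k))
    (N : lp (fun _ : ℤ => Lp ℂ 2 μT) 2 →L[ℂ] lp (fun _ : ℤ => Lp ℂ 2 μT) 2)
    (hN : N ∈ Set.centralizer (Set.centralizer (Set.range π ∪ Set.range U)))
    (b : HilbertBasis (ℤ × ℤ) ℂ (lp (fun _ : ℤ => Lp ℂ 2 μT) 2))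
    (hb : ∀ u, b u = lp.single 2 u.1 (fourierLp 2 u.2)) (u v w : ℤ × ℤ) :
    ‖inner ℂ (b (u + w)) (N (b (v + w)))‖ₑ = ‖inner ℂ (b u) (N (b v))‖ₑ := by
  let s : AddCircle (1 : ℝ) := ((w.1 : ℝ) * θ : ℝ)
  obtain ⟨S, hS⟩ : ∃ S, S = (lpFiberwise (I := ℤ)
    (translateModulate s w.2)).toContinuousLinearMap * U w.1 := ⟨_, rfl⟩
  have hS' : ∀ ξ, S ξ = lpFiberwise (translateModulate s w.2) (U w.1 ξ) := fun ξ => by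
    rw [hS]
    rfl
  have hSapp : ∀ ξ m, S ξ m = translateModulate s w.2 (ξ (m - w.1)) := fun ξ m => by
    rw [hS', lpFiberwise_apply, hU]
  have hSU : ∀ k, U k * S = S * U k := fun k => by
    ext1 ξ
    ext1
    funext m
    rw [mul_apply_eq_comp, mul_apply_eq_comp, hU, hSapp, hSapp, hU, sub_right_comm]
  have hSπ : ∀ g, π g * S = S * π g := fun g => by
    ext1 ξ
    ext1
    funext m
    rw [mul_apply_eq_comp, mul_apply_eq_comp]
    refine Lp.ext ?_
    filter_upwards [hπ g (S ξ) m, coeFn_translateModulate s w.2 (ξ (m - w.1)),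
      coeFn_translateModulate s w.2 (π g ξ (m - w.1)),
      (measurePreserving_sub_right μT s).quasiMeasurePreserving.ae (hπ g ξ (m - w.1))]
      with x h1 h2 h3 h4
    rw [h1, hSapp, hSapp, h2, h3, h4]
    have : x - s - (((m - w.1 : ℤ) * θ : ℝ) : AddCircle (1 : ℝ))
        = x - ((m * θ : ℝ) : AddCircle (1 : ℝ)) := by
      rw [sub_sub, ← AddCircle.coe_add]
      congr 2
      push_cast
      ring
    rw [this]
    ring
  have hNS : S * N = N * S := by
    refine hN S ?_
    rintro _ (⟨g, rfl⟩ | ⟨k, rfl⟩)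
    · exact hSπ g
    · exact hSU k
  have hSb : ∀ v : ℤ × ℤ, ∃ c : ℂ, ‖c‖ₑ = 1 ∧ S (b v) = c • b (v + w) := fun v => by
    refine ⟨fourier v.2 (-s), ?_, ?_⟩
    · rw [← ofReal_norm, fourier_apply, Circle.norm_coe, ENNReal.ofReal_one]
    · have hUb : U w.1 (b v) = lp.single 2 (v.1 + w.1) (fourierLp 2 v.2) := by
        ext1
        funext m
        rw [hU, hb, lp.single_apply, lp.single_apply, Pi.single_apply, Pi.single_apply]
        simp only [sub_eq_iff_eq_add]
      rw [hS', hUb, lpFiberwise_single, translateModulate_fourierLp, hb, lp.single_smul]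
      rfl
  have hSinner : ∀ ξ η, inner ℂ (S ξ) (S η) = inner ℂ ξ η := fun ξ η => by
    have hUinner : inner ℂ (U w.1 ξ) (U w.1 η) = inner ℂ ξ η := by
      rw [lp.inner_eq_tsum, lp.inner_eq_tsum,
        ← (Equiv.subRight w.1).tsum_eq (fun m => inner ℂ (ξ m) (η m))]
      simp only [hU, Equiv.subRight_apply]
    rw [← hUinner, hS', hS', LinearIsometry.inner_map_map]
  obtain ⟨c, hc, hcu⟩ := hSb u
  obtain ⟨d, hd, hdv⟩ := hSb v
  have h := hSinner (b u) (N (b v))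
  have hcomm : S (N (b v)) = N (S (b v)) := DFunLike.congr_fun hNS (b v)
  rw [hcomm, hcu, hdv, map_smul, inner_smul_left, inner_smul_right] at h
  rw [← h, enorm_mul, enorm_mul, RCLike.enorm_conj, hc, hd, one_mul, one_mul]

theorem stmt19 (θ : ℝ) (hθ : Irrational θ)
    -- an orthonormal basis of `K = ℓ²(ℤ, L²(𝕋))` computing Hilbert-Schmidt norms
    {ι : Type*} (eK : HilbertBasis ι ℂ (lp (fun _ : ℤ => Lp ℂ 2 μT) 2))
    -- the covariant representation of `(L^∞(𝕋), ℤ, α)` on `K`: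
    -- `(π g ξ)(m) = M_{α_{-m}(g)} (ξ m)`, where `α_k(g) = g(· + kθ)`
    (π : Lp ℂ ∞ μT → (lp (fun _ : ℤ => Lp ℂ 2 μT) 2 →L[ℂ] lp (fun _ : ℤ => Lp ℂ 2 μT) 2))
    (hπ : ∀ (g : Lp ℂ ∞ μT) (ξ : lp (fun _ : ℤ => Lp ℂ 2 μT) 2) (m : ℤ),
      ((π g ξ) m : AddCircle (1:ℝ) → ℂ) =ᵐ[μT]
        fun x => (g : AddCircle (1:ℝ) → ℂ) (x - (((m:ℝ) * θ : ℝ) : AddCircle (1:ℝ)))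
          * ((ξ m : Lp ℂ 2 μT) : AddCircle (1:ℝ) → ℂ) x)
    -- the translation unitaries `(U k ξ)(m) = ξ (m - k)`
    (U : ℤ → (lp (fun _ : ℤ => Lp ℂ 2 μT) 2 →L[ℂ] lp (fun _ : ℤ => Lp ℂ 2 μT) 2))
    (hU : ∀ (k : ℤ) (ξ : lp (fun _ : ℤ => Lp ℂ 2 μT) 2) (m : ℤ), (U k ξ) m = ξ (m - k))
    -- `Q n` is the orthogonal projection of `L²(𝕋)` onto `span {ε_0, …, ε_n}`
    (Q : ℕ → (Lp ℂ 2 μT →L[ℂ] Lp ℂ 2 μT))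
    (hQsa : ∀ n, IsSelfAdjoint (Q n)) (hQidem : ∀ n, Q n * Q n = Q n)
    (hQrange : ∀ n, LinearMap.range ((Q n : Lp ℂ 2 μT →ₗ[ℂ] Lp ℂ 2 μT))
      = Submodule.span ℂ {h : Lp ℂ 2 μT | ∃ k : ℕ, k ≤ n ∧ h = fourierLp 2 (k : ℤ)})
    -- the projections `R n = P n ⊗ Q n` on `K`
    (R : ℕ → (lp (fun _ : ℤ => Lp ℂ 2 μT) 2 →L[ℂ] lp (fun _ : ℤ => Lp ℂ 2 μT) 2))
    (hR : ∀ (n : ℕ) (ξ : lp (fun _ : ℤ => Lp ℂ 2 μT) 2) (m : ℤ),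
      (R n ξ) m = if m ∈ Finset.Icc (-(n:ℤ)) (n:ℤ) then Q n (ξ m) else 0) :
    -- `{R n}` is a Følner sequence for the von Neumann algebra `𝒩_θ = L^∞(𝕋) ⊗_α ℤ`
    ∀ N ∈ Set.centralizer (Set.centralizer (Set.range π ∪ Set.range U)),
      Tendsto (fun n => hsNorm eK (N * R n - R n * N) / hsNorm eK (R n)) atTop (nhds 0) := by
  classical
  obtain ⟨b, hb⟩ : ∃ b : HilbertBasis (ℤ × ℤ) ℂ (lp (fun _ : ℤ => Lp ℂ 2 μT) 2),
      ∀ u, b u = lp.single 2 u.1 (fourierLp 2 u.2) :=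
    ⟨(fourierBasis (T := (1 : ℝ))).lpSingle, fun u => by
      rw [HilbertBasis.lpSingle_apply, coe_fourierBasis]⟩
  have hQ := fun n => proj_fourierLp n (Q n) (hQsa n) (hQidem n) (hQrange n)
  intro N hN
  refine tendsto_hsNorm_commutator_div eK b N R box (fun u v w => ?_) (fun n v => ?_)
    (fun n u x => ?_) tendsto_outCard_box_div
  · exact enorm_inner_crossedProduct_add θ π hπ U hU N hN b hb u v w
  · rw [hb]
    ext1
    funext m
    rw [hR, lp.single_apply, Pi.single_apply]
    simp only [box, Finset.mem_product, ite_and]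
    by_cases hm : m = v.1
    · rw [if_pos hm, hQ, hm]
      split_ifs
      · rw [lp.single_apply_self]
      · rfl
      · rfl
    · rw [if_neg hm, map_zero, ite_self]
      split_ifs
      · rw [lp.single_apply_ne _ _ _ hm]
      · rfl
      · rfl
  · rw [hb, lp.inner_single_left, hR]
    have hQx : inner ℂ (fourierLp 2 u.2) (Q n (x u.1))
        = if u.2 ∈ Finset.Icc 0 (n : ℤ) then inner ℂ (fourierLp 2 u.2) (x u.1) else 0 := by
      rw [← ContinuousLinearMap.adjoint_inner_left, (hQsa n).adjoint_eq, hQ]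
      split_ifs
      · rfl
      · exact inner_zero_left _
    simp only [box, Finset.mem_product, ite_and]
    rw [lp.inner_single_left, ← hQx]
    split_ifs
    · rfl
    · exact inner_zero_right _
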